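/- Let x be a vector in the James Tree space JT whose support is contained in a union ⋃_{i∈I} S_i of pairwise incomparable segments of T (no node of S_i is comparable in the tree order to any node of S_j for i ≠ j). If x is separated, then ‖x‖_{JT} = ‖x‖₂, and consequently x is an extreme point of the ball of radius ‖x‖_{JT}. -/

import Mathlib

/-! Common framework for the James Tree space `JT`.

The dyadic tree is modelled as `List Bool`, ordered by `List.IsPrefix` (`<+:`). -/

abbrev DyadicNode := List Bool

namespace JTSpace

/-- A segment of the dyadic tree: a linearly ordered, order-convex subset. -/
def IsSegment (S : Set DyadicNode) : Prop :=
  (∀ a ∈ S, ∀ b ∈ S, a <+: b ∨ b <+: a) ∧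
  (∀ a ∈ S, ∀ b ∈ S, ∀ c : DyadicNode, a <+: c → c <+: b → c ∈ S)

/-- A partition: a family of pairwise disjoint segments. -/
def IsPartition (P : Set (Set DyadicNode)) : Prop :=
  (∀ S ∈ P, IsSegment S) ∧ P.PairwiseDisjoint id

/-- The sum of `x` along a set of nodes. -/
noncomputable def segSum (x : DyadicNode → ℝ) (S : Set DyadicNode) : ℝ :=
  ∑' a : S, x a

/-- The square of the value `‖x‖_P` of `x` on the partition `P`. -/
noncomputable def pNormSq (x : DyadicNode → ℝ) (P : Set (Set DyadicNode)) : ℝ :=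
  ∑' S : P, (segSum x S) ^ 2

/-- The set of all values `‖x‖_P²` over partitions `P`. -/
def normSqSet (x : DyadicNode → ℝ) : Set ℝ :=
  {r | ∃ P, IsPartition P ∧ r = pNormSq x P}

/-- The square of the `JT` norm. -/
noncomputable def JTnormSq (x : DyadicNode → ℝ) : ℝ := sSup (normSqSet x)

/-- The `JT` norm of `x`. -/
noncomputable def JTnorm (x : DyadicNode → ℝ) : ℝ := Real.sqrt (JTnormSq x)

/-- The `ℓ₂` norm of `x`. -/
noncomputable def l2norm (x : DyadicNode → ℝ) : ℝ := Real.sqrt (∑' a, (x a) ^ 2)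

def HasBddNorm (x : DyadicNode → ℝ) : Prop := BddAbove (normSqSet x)

/-- `x` belongs to the James Tree space: its norm is finite and it is approximable in the
`JT` norm by finitely supported functions (`JT` is the completion of `c₀₀(T)`). -/
def MemJT (x : DyadicNode → ℝ) : Prop :=
  HasBddNorm x ∧
  ∀ ε > (0 : ℝ), ∃ y : DyadicNode → ℝ, (Function.support y).Finite ∧
    HasBddNorm (x - y) ∧ JTnorm (x - y) ≤ ε

/-- An `x`-norming partition. -/
def IsNormingPartition (x : DyadicNode → ℝ) (P : Set (Set DyadicNode)) : Prop :=
  IsPartition P ∧ pNormSq x P = JTnormSq x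

/-- A complete subtree of the dyadic tree. -/
def IsCompleteSubtree (K : Set DyadicNode) : Prop :=
  ∀ a ∈ K, ∀ b ∈ K, ∀ c : DyadicNode, a <+: c → c <+: b → c ∈ K

/-- The range of `x`: the smallest complete subtree containing the support of `x`. -/
def ran (x : DyadicNode → ℝ) : Set DyadicNode :=
  ⋂₀ {K | IsCompleteSubtree K ∧ Function.support x ⊆ K}

/-- `x` is separated: every two distinct nodes of `ran x` are separated by some
`x`-norming partition. -/
def Separated (x : DyadicNode → ℝ) : Prop :=
  ∀ a ∈ ran x, ∀ b ∈ ran x, a ≠ b →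
    ∃ P, IsNormingPartition x P ∧ ∃ S ∈ P, ∃ S' ∈ P, S ≠ S' ∧ a ∈ S ∧ b ∈ S'

/-- `x` is an extreme point of the ball of radius `‖x‖_{JT}`. -/
def IsExtremePoint (x : DyadicNode → ℝ) : Prop :=
  x ≠ 0 ∧
  ∀ y z : DyadicNode → ℝ, MemJT y → MemJT z →
    ∀ l : ℝ, 0 < l → l < 1 → x = l • y + (1 - l) • z →
      JTnorm y = JTnorm x → JTnorm z = JTnorm x → y = x ∧ z = x

/-- A branch: a maximal segment. -/
def IsBranch (b : Set DyadicNode) : Prop :=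
  IsSegment b ∧ ∀ S : Set DyadicNode, IsSegment S → b ⊆ S → S = b

/-- The wedge rooted at `a`. -/
def wedge (a : DyadicNode) : Set DyadicNode := {b | a <+: b}

/-- The two children of a node. -/
def children (u : DyadicNode) : Set DyadicNode := {u ++ [false], u ++ [true]}

/-- The maximal segment sum starting at `a`:
`S_a(x) = sup { S_s(x) : s a segment with min s = a }`. -/
noncomputable def maxSum (x : DyadicNode → ℝ) (a : DyadicNode) : ℝ :=
  sSup {r | ∃ s : Set DyadicNode, IsSegment s ∧ a ∈ s ∧ (∀ b ∈ s, a <+: b) ∧ r = segSum x s}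

/-- The children of `u` within the subtree spanned by the support of `x`. -/
def supportedChildren (x : DyadicNode → ℝ) (u : DyadicNode) : Set DyadicNode :=
  {c ∈ children u | ∃ b ∈ Function.support x, c <+: b}

/-- A greedy partition for a positive vector `x`: a partition whose segments cover the
support of `x` and such that every segment, at every support node `u` which has a strict
descendant in the support, continues through a child of `u` (within the subtree spanned by
the support) maximizing the maximal segment sum, down to the next element of the support;
at support nodes with no strict descendant in the support, the segment's support ends. -/
def IsGreedyPartition (x : DyadicNode → ℝ) (P : Set (Set DyadicNode)) : Prop :=
  IsPartition P ∧ Function.support x ⊆ ⋃₀ P ∧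
  ∀ s ∈ P, ∀ u ∈ s ∩ Function.support x,
    ((∃ w ∈ Function.support x, u <+: w ∧ u ≠ w) →
      ∃ v ∈ s ∩ Function.support x, u <+: v ∧ u ≠ v ∧
        (∀ w ∈ s ∩ Function.support x, u <+: w → u ≠ w → v <+: w) ∧
        ∃ c ∈ supportedChildren x u, c <+: v ∧
          ∀ k ∈ supportedChildren x u, maxSum x k ≤ maxSum x c) ∧
    ((¬ ∃ w ∈ Function.support x, u <+: w ∧ u ≠ w) →
      ∀ w ∈ s ∩ Function.support x, w <+: u)



open scoped Classical in
lemma segSum_finset (x : DyadicNode → ℝ) (S : Set DyadicNode) (F : Finset DyadicNode)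
    (h : ∀ a ∈ S, x a ≠ 0 → a ∈ F) : segSum x S = ∑ a ∈ F.filter (· ∈ S), x a := by
  unfold segSum
  rw [tsum_subtype S x, tsum_eq_sum (s := F.filter (· ∈ S))]
  · apply Finset.sum_congr rfl
    intro a ha
    rw [Set.indicator_of_mem (Finset.mem_filter.1 ha).2]
  · intro a ha
    by_contra hne
    have haS : a ∈ S := Set.mem_of_indicator_ne_zero hne
    rw [Set.indicator_of_mem haS] at hne
    exact ha (Finset.mem_filter.2 ⟨h a haS hne, haS⟩)

lemma segSum_coe (x : DyadicNode → ℝ) (F : Finset DyadicNode) :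
    segSum x (F : Set DyadicNode) = ∑ a ∈ F, x a := by
  classical
  rw [segSum_finset x _ F (fun a ha _ => ha)]
  apply Finset.sum_congr _ (fun _ _ => rfl)
  ext a; simp

lemma segSum_empty (x : DyadicNode → ℝ) : segSum x ∅ = 0 := by
  simp [segSum]

lemma segSum_singleton (x : DyadicNode → ℝ) (a : DyadicNode) : segSum x {a} = x a := by
  have := segSum_coe x {a}
  simpa using this

lemma isSegment_singleton (a : DyadicNode) : IsSegment {a} := by
  refine ⟨?_, ?_⟩
  · rintro _ rfl _ rfl; exact Or.inl List.prefix_rfl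
  · rintro _ rfl _ rfl c h1 h2
    exact (h2.eq_of_length_le h1.length_le)

lemma isSegment_empty : IsSegment ∅ := by
  refine ⟨?_, ?_⟩ <;> simp

lemma fam_le {x : DyadicNode → ℝ} (hb : HasBddNorm x) {κ : Type*} (F : Finset κ)
    (V : κ → Set DyadicNode) (hseg : ∀ i ∈ F, IsSegment (V i))
    (hd : ∀ i ∈ F, ∀ j ∈ F, i ≠ j → Disjoint (V i) (V j)) :
    ∑ i ∈ F, (segSum x (V i)) ^ 2 ≤ JTnormSq x := by
  classical
  let G := F.filter (fun i => V i ≠ ∅)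
  have hinj : Set.InjOn V (G : Set κ) := by
    intro i hi j hj hij
    by_contra hne
    have hi' := Finset.mem_filter.1 hi
    have hj' := Finset.mem_filter.1 hj
    have := hd i hi'.1 j hj'.1 hne
    rw [← hij, disjoint_self] at this
    exact hi'.2 this
  have h1 : ∑ i ∈ F, (segSum x (V i)) ^ 2 = ∑ i ∈ G, (segSum x (V i)) ^ 2 := by
    symm
    apply Finset.sum_subset (Finset.filter_subset _ _)
    intro i hi hiG
    have : V i = ∅ := by
      by_contra h; exact hiG (Finset.mem_filter.2 ⟨hi, h⟩)
    rw [this, segSum_empty]; norm_num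
  let P : Finset (Set DyadicNode) := G.image V
  have h2 : ∑ i ∈ G, (segSum x (V i)) ^ 2 = ∑ S ∈ P, (segSum x S) ^ 2 := by
    rw [Finset.sum_image hinj]
  have h3 : ∑ S ∈ P, (segSum x S) ^ 2 = pNormSq x (P : Set (Set DyadicNode)) := by
    unfold pNormSq
    rw [← Finset.tsum_subtype P (fun S => (segSum x S) ^ 2)]
    rfl
  rw [h1, h2, h3]
  apply le_csSup hb
  refine ⟨_, ⟨?_, ?_⟩, rfl⟩
  · intro S hS
    obtain ⟨i, hi, rfl⟩ := Finset.mem_image.1 hS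
    exact hseg i (Finset.mem_filter.1 hi).1
  · intro S hS S' hS' hne
    obtain ⟨i, hi, rfl⟩ := Finset.mem_image.1 hS
    obtain ⟨j, hj, rfl⟩ := Finset.mem_image.1 hS'
    exact hd i (Finset.mem_filter.1 hi).1 j (Finset.mem_filter.1 hj).1
      (fun h => hne (by rw [h]))

lemma JTnormSq_nonneg {x : DyadicNode → ℝ} (hb : HasBddNorm x) : 0 ≤ JTnormSq x := by
  have := fam_le hb (∅ : Finset ℕ) (fun _ => ∅) (by simp) (by simp)
  simpa using this

lemma sq_sum_le {x : DyadicNode → ℝ} (hb : HasBddNorm x) (F : Finset DyadicNode) :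
    ∑ a ∈ F, (x a) ^ 2 ≤ JTnormSq x := by
  have := fam_le hb F (fun a => {a}) (fun a _ => isSegment_singleton a)
    (fun a _ b _ h => by simpa using h)
  simpa [segSum_singleton] using this

lemma sq_summable {x : DyadicNode → ℝ} (hb : HasBddNorm x) : Summable (fun a => (x a) ^ 2) :=
  summable_of_sum_le (fun _ => sq_nonneg _) (sq_sum_le hb)

lemma sq_tsum_le {x : DyadicNode → ℝ} (hb : HasBddNorm x) :
    ∑' a, (x a) ^ 2 ≤ JTnormSq x :=
  (sq_summable hb).tsum_le_of_sum_le (sq_sum_le hb)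

lemma p_summable {x : DyadicNode → ℝ} (hb : HasBddNorm x) {P : Set (Set DyadicNode)}
    (hP : IsPartition P) : Summable (fun S : P => (segSum x S) ^ 2) := by
  apply summable_of_sum_le (c := JTnormSq x) (fun _ => sq_nonneg _)
  intro F
  apply fam_le hb F (fun S => (S : Set DyadicNode)) (fun S _ => hP.1 S S.2)
  intro S _ S' _ h
  exact hP.2 S.2 S'.2 (fun h' => h (Subtype.ext h'))

/-- Given the summed claim on segments, extremality is elementary. -/
lemma extreme_of_eq {x : DyadicNode → ℝ} (hb : HasBddNorm x)
    (h : JTnormSq x = ∑' a, (x a) ^ 2) (hx0 : x ≠ 0) : IsExtremePoint x := by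
  refine ⟨hx0, ?_⟩
  intro y z hy hz l hl0 hl1 hxyz hny hnz
  have ey : JTnormSq y = JTnormSq x := by
    unfold JTnorm at hny
    exact (Real.sqrt_inj (JTnormSq_nonneg hy.1) (JTnormSq_nonneg hb)).1 hny
  have ez : JTnormSq z = JTnormSq x := by
    unfold JTnorm at hnz
    exact (Real.sqrt_inj (JTnormSq_nonneg hz.1) (JTnormSq_nonneg hb)).1 hnz
  have sx := sq_summable hb
  have sy := sq_summable hy.1
  have sz := sq_summable hz.1
  have iy := sq_tsum_le hy.1
  have iz := sq_tsum_le hz.1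
  have hpt : ∀ a, x a = l * y a + (1 - l) * z a := by
    intro a; rw [hxyz]; simp
  have hid : (fun a => l * (1 - l) * (y a - z a) ^ 2) =
      fun a => (l * (y a) ^ 2 + (1 - l) * (z a) ^ 2) - (x a) ^ 2 := by
    funext a; rw [hpt a]; ring
  have hsum : HasSum (fun a => (l * (y a) ^ 2 + (1 - l) * (z a) ^ 2) - (x a) ^ 2)
      ((l * ∑' a, (y a) ^ 2 + (1 - l) * ∑' a, (z a) ^ 2) - ∑' a, (x a) ^ 2) :=
    ((sy.hasSum.mul_left l).add (sz.hasSum.mul_left (1 - l))).sub sx.hasSum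
  rw [← hid] at hsum
  have hyz : ∀ a, y a = z a := by
    intro a
    have hle := le_hasSum hsum a (fun b _ => by
      have : 0 < l * (1 - l) := mul_pos hl0 (by linarith)
      positivity)
    have hneg : (l * ∑' a, (y a) ^ 2 + (1 - l) * ∑' a, (z a) ^ 2) - ∑' a, (x a) ^ 2 ≤ 0 := by
      rw [← h]
      rw [ey] at iy
      rw [ez] at iz
      nlinarith
    have hp : 0 < l * (1 - l) := mul_pos hl0 (by linarith)
    have : (y a - z a) ^ 2 ≤ 0 := by
      by_contra hc
      push Not at hc
      have := mul_pos hp hc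
      linarith
    have : (y a - z a) = 0 := by nlinarith [sq_nonneg (y a - z a), pow_eq_zero_iff (M₀ := ℝ) (n := 2) (a := y a - z a) (by norm_num)]
    linarith
  constructor
  · funext a; rw [hpt a, ← hyz a]; ring
  · funext a; rw [hpt a, hyz a]; ring

/-- From the finite interval inequality to the inequality for every segment. -/
lemma seg_le {x : DyadicNode → ℝ} (hb : HasBddNorm x)
    (key : ∀ U : Finset DyadicNode, IsSegment (U : Set DyadicNode) →
      (∑ a ∈ U, x a) ^ 2 ≤ ∑ a ∈ U, (x a) ^ 2) (S : Set DyadicNode) (hS : IsSegment S) :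
    (segSum x S) ^ 2 ≤ ∑' a : S, (x a) ^ 2 := by
  classical
  have hs2 : Summable (fun a : S => (x a) ^ 2) := (sq_summable hb).subtype S
  by_cases hs : Summable (fun a : S => x a)
  · have ht : Filter.Tendsto (fun F : Finset S => (∑ a ∈ F, x a) ^ 2) Filter.atTop
        (nhds ((segSum x S) ^ 2)) := (hs.hasSum).pow 2
    refine le_of_tendsto_of_frequently ht ?_
    rw [Filter.frequently_atTop]
    intro F
    let U : Finset DyadicNode :=
      ((F.image Subtype.val).biUnion (fun b => b.inits.toFinset)).filter (· ∈ S)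
    have hUS : ∀ c ∈ U, c ∈ S := fun c hc => (Finset.mem_filter.1 hc).2
    have hU : ∀ c, c ∈ U ↔ c ∈ S ∧ ∃ b ∈ F, c <+: b.1 := by
      intro c
      simp only [U, Finset.mem_filter, Finset.mem_biUnion, Finset.mem_image, List.mem_toFinset,
        List.mem_inits]
      constructor
      · rintro ⟨⟨_, ⟨b, hb, rfl⟩, h⟩, h'⟩; exact ⟨h', b, hb, h⟩
      · rintro ⟨h', b, hb, h⟩; exact ⟨⟨_, ⟨b, hb, rfl⟩, h⟩, h'⟩
    have hUseg : IsSegment (U : Set DyadicNode) := by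
      refine ⟨fun a ha b hb => hS.1 a (hUS a ha) b (hUS b hb), ?_⟩
      intro a ha b hb c hac hcb
      have hb' := (hU b).1 hb
      obtain ⟨d, hd, hbd⟩ := hb'.2
      exact (hU c).2 ⟨hS.2 a (hUS a ha) b hb'.1 c hac hcb, d, hd, hcb.trans hbd⟩
    refine ⟨U.subtype (· ∈ S), ?_, ?_⟩
    · intro b hbF
      rw [Finset.mem_subtype]
      exact (hU _).2 ⟨b.2, b, hbF, List.prefix_rfl⟩
    · have e1 : ∑ a ∈ U.subtype (· ∈ S), x a = ∑ a ∈ U, x a :=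
        Finset.sum_subtype_of_mem x hUS
      have e2 : ∑ a ∈ U.subtype (· ∈ S), (x a) ^ 2 = ∑ a ∈ U, (x a) ^ 2 :=
        Finset.sum_subtype_of_mem (fun a => (x a) ^ 2) hUS
      have := key U hUseg
      rw [← e1, ← e2] at this
      exact this.trans (hs2.sum_le_tsum _ (fun _ _ => sq_nonneg _))
  · have : segSum x S = 0 := tsum_eq_zero_of_not_summable hs
    rw [this]
    have : 0 ≤ ∑' a : S, (x a) ^ 2 := tsum_nonneg (fun _ => sq_nonneg _)
    simpa using this

lemma normSq_eq {x : DyadicNode → ℝ} (hb : HasBddNorm x)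
    (key : ∀ U : Finset DyadicNode, IsSegment (U : Set DyadicNode) →
      (∑ a ∈ U, x a) ^ 2 ≤ ∑ a ∈ U, (x a) ^ 2) : JTnormSq x = ∑' a, (x a) ^ 2 := by
  apply le_antisymm _ (sq_tsum_le hb)
  apply csSup_le
  · exact ⟨_, ∅, ⟨by simp, by simp⟩, rfl⟩
  · rintro r ⟨P, hP, rfl⟩
    have hsq := sq_summable hb
    have hinj : Function.Injective
        (fun p : (Σ S : P, (S : Set DyadicNode)) => (p.2 : DyadicNode)) := by
      rintro ⟨S, a, ha⟩ ⟨S', a', ha'⟩ h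
      dsimp only at h
      subst h
      have : S = S' := by
        by_contra hne
        have := hP.2 S.2 S'.2 (fun h' => hne (Subtype.ext h'))
        exact Set.disjoint_left.1 this ha ha'
      subst this
      rfl
    have hsig := hsq.comp_injective hinj
    have e1 : ∑' p : (Σ S : P, (S : Set DyadicNode)), (x p.2) ^ 2 =
      ∑' S : P, ∑' a : (S : Set DyadicNode), (x a) ^ 2 := hsig.tsum_sigma
    calc pNormSq x P ≤ ∑' S : P, ∑' a : (S : Set DyadicNode), (x a) ^ 2 :=
          (p_summable hb hP).tsum_le_tsum (fun S => seg_le hb key S (hP.1 S S.2)) hsig.sigma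
      _ = ∑' p : (Σ S : P, (S : Set DyadicNode)), (x p.2) ^ 2 := e1.symm
      _ ≤ ∑' a, (x a) ^ 2 :=
          hsig.tsum_le_tsum_of_inj _ hinj (fun _ _ => sq_nonneg _) (fun _ => le_rfl) hsq

lemma segSum_union {x : DyadicNode → ℝ} {A B : Set DyadicNode} (h : Disjoint A B)
    (hA : Summable (fun a : A => x a)) (hB : Summable (fun a : B => x a)) :
    segSum x (A ∪ B) = segSum x A + segSum x B :=
  Summable.tsum_union_disjoint (f := x) h hA hB

/-- The gain obtained by reorganising `U` and the segment `S` through `b`. -/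
lemma gain {x : DyadicNode → ℝ} {b : DyadicNode} {U : Finset DyadicNode}
    {S : Set DyadicNode} (hUseg : IsSegment (U : Set DyadicNode)) (hbU : b ∈ U)
    (hUb : ∀ c ∈ U, c <+: b) (hS : IsSegment S) (hbS : b ∈ S)
    (hSb : ∀ c ∈ S, c <+: b → c ∈ U)
    (hSU : ∀ c ∈ S, c ∈ U → x c ≠ 0 → c = b)
    (hA : (∑ a ∈ U.erase b, x a) ^ 2 ≤ ∑ a ∈ U.erase b, (x a) ^ 2)
    (hlt : ∑ a ∈ U, (x a) ^ 2 < (∑ a ∈ U, x a) ^ 2) :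
    ∃ W : Bool → Set DyadicNode, (∀ i, IsSegment (W i)) ∧ Disjoint (W true) (W false) ∧
      (∀ i, W i ⊆ (U : Set DyadicNode) ∪ S) ∧
      ∑ a ∈ U.erase b, (x a) ^ 2 + (segSum x S) ^ 2 <
        (segSum x (W true)) ^ 2 + (segSum x (W false)) ^ 2 := by
  classical
  rw [← Finset.add_sum_erase U _ hbU, ← Finset.add_sum_erase U x hbU] at hlt
  have hsU : segSum x (U : Set DyadicNode) = x b + ∑ a ∈ U.erase b, x a := by
    rw [segSum_coe, Finset.add_sum_erase U x hbU]
  set A := ∑ a ∈ U.erase b, x a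
  set Q := ∑ a ∈ U.erase b, (x a) ^ 2
  have hcase : ∀ c ∈ S, c ∈ U ∨ b <+: c := by
    intro c hc
    rcases hS.1 c hc b hbS with h | h
    · exact Or.inl (hSb c hc h)
    · exact Or.inr h
  by_cases hs : Summable (fun a : S => x a)
  · have hsub : Summable (fun a : (S \ U : Set DyadicNode) => x a) :=
      hs.comp_injective (Set.inclusion_injective Set.sdiff_subset)
    have hsub' : Summable (fun a : (S ∩ U : Set DyadicNode) => x a) :=
      hs.comp_injective (Set.inclusion_injective Set.inter_subset_left)
    have hSb1 : segSum x (S ∩ U) = x b := by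
      rw [segSum_finset x _ {b} (fun a ha h0 => by simpa using hSU a ha.1 ha.2 h0)]
      rw [Finset.filter_singleton, if_pos ⟨hbS, hbU⟩, Finset.sum_singleton]
    have hSsum : segSum x S = x b + segSum x (S \ U) := by
      conv_lhs => rw [← Set.inter_union_sdiff S (U : Set DyadicNode)]
      rw [segSum_union (Set.disjoint_left.2 (fun a h h' => h'.2 h.2)) hsub' hsub, hSb1]
    have hUsum : Summable (fun a : (U : Set DyadicNode) => x a) :=
      (hasSum_fintype _).summable
    have hUSsum : segSum x ((U : Set DyadicNode) ∪ S) = x b + A + segSum x (S \ U) := by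
      rw [← Set.union_sdiff_self,
        segSum_union (Set.disjoint_left.2 (fun a h h' => h'.2 h)) hUsum hsub, hsU]
    set t := segSum x (S \ U)
    by_cases hsign : 0 ≤ x b * t
    · refine ⟨fun i => if i then (U : Set DyadicNode) ∪ S else ∅, ?_, by simp, ?_, ?_⟩
      · have hseg : IsSegment ((U : Set DyadicNode) ∪ S) := by
          constructor
          · have hmix : ∀ a ∈ U, ∀ c ∈ S, a <+: c ∨ c <+: a := by
              intro a ha c hc
              rcases hcase c hc with h | h
              · exact hUseg.1 a ha c h
              · exact Or.inl ((hUb a ha).trans h)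
            rintro a (ha | ha) c (hc | hc)
            · exact hUseg.1 a ha c hc
            · exact hmix a ha c hc
            · exact (hmix c hc a ha).symm
            · exact hS.1 a ha c hc
          · rintro a ha d hd c hac hcd
            by_cases hcb : c <+: b
            · left
              rcases ha with ha | ha
              · exact hUseg.2 a ha b hbU c hac hcb
              · exact hSb c (hS.2 a ha b hbS c hac hcb) hcb
            · right
              have hdS : d ∈ S := by
                rcases hd with hd | hd
                · exact absurd (hcd.trans (hUb d hd)) hcb
                · exact hd
              have hbd : b <+: d := by
                rcases hS.1 d hdS b hbS with h | h
                · exact absurd (hcd.trans h) hcb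
                · exact h
              have hbc : b <+: c := by
                rcases List.prefix_or_prefix_of_prefix hbd hcd with h | h
                · exact h
                · exact absurd h hcb
              exact hS.2 b hbS d hdS c hbc hcd
        intro i
        cases i
        · simpa using isSegment_empty
        · simpa using hseg
      · intro i; cases i <;> simp
      · simp only [if_true, Bool.false_eq_true, if_false, segSum_empty]
        rw [hUSsum, hSsum]
        have hAx : 0 < A * x b := by nlinarith
        have hAt : 0 ≤ A * t := by
          have h1 : 0 ≤ (A * t) * (x b) ^ 2 := by
            have := mul_nonneg hAx.le hsign
            nlinarith
          have h2 : 0 < (x b) ^ 2 := by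
            have : x b ≠ 0 := fun h => by rw [h] at hAx; simp at hAx
            positivity
          exact nonneg_of_mul_nonneg_left h1 h2
        nlinarith
    · push Not at hsign
      refine ⟨fun i => if i then (U : Set DyadicNode) else S \ U, ?_, ?_, ?_, ?_⟩
      · intro i
        cases i
        · simp only [Bool.false_eq_true, if_false]
          refine ⟨fun a ha c hc => hS.1 a ha.1 c hc.1, ?_⟩
          intro a ha d hd c hac hcd
          refine ⟨hS.2 a ha.1 d hd.1 c hac hcd, ?_⟩
          intro hcU
          exact ha.2 (hSb a ha.1 (hac.trans (hUb c hcU)))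
        · simpa using hUseg
      · simpa using Set.disjoint_sdiff_right
      · intro i
        cases i
        · simp only [Bool.false_eq_true, if_false]
          exact Set.sdiff_subset.trans Set.subset_union_right
        · simp
      · simp only [if_true, Bool.false_eq_true, if_false]
        rw [hsU, hSsum]
        change _ < _ + t ^ 2
        nlinarith
  · have h0 : segSum x S = 0 := tsum_eq_zero_of_not_summable hs
    refine ⟨fun i => if i then (U : Set DyadicNode) else ∅, ?_, by simp, ?_, ?_⟩
    · intro i
      cases i
      · simpa using isSegment_empty
      · simpa using hUseg
    · intro i; cases i <;> simp
    · simp only [if_true, Bool.false_eq_true, if_false, segSum_empty]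
      rw [hsU, h0]
      nlinarith [sq_nonneg (x b)]

lemma mem_ran {x : DyadicNode → ℝ} {a : DyadicNode} (h : x a ≠ 0) : a ∈ ran x := by
  intro K hK
  exact hK.2 h

lemma step {x : DyadicNode → ℝ} (hb : HasBddNorm x) (hsep : Separated x)
    (hC : ∀ a u b, x a ≠ 0 → x u ≠ 0 → x b ≠ 0 → a <+: u → a <+: b → u <+: b ∨ b <+: u)
    {b : DyadicNode} {U : Finset DyadicNode}
    (hUseg : IsSegment (U : Set DyadicNode)) (hbU : b ∈ U)
    (hUb : ∀ c ∈ U, c <+: b) (hxb : x b ≠ 0) (hUa : ∀ c ∈ U, ∃ a ∈ U, x a ≠ 0 ∧ a <+: c)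
    (IH : ∀ V : Finset DyadicNode, IsSegment (V : Set DyadicNode) →
      (∀ c ∈ V, c.length < b.length) → (∑ a ∈ V, x a) ^ 2 ≤ ∑ a ∈ V, (x a) ^ 2) :
    (∑ a ∈ U, x a) ^ 2 ≤ ∑ a ∈ U, (x a) ^ 2 := by
  classical
  by_contra hlt
  push Not at hlt
  have hlen : ∀ c, c <+: b → c ≠ b → c.length < b.length := by
    intro c hc hne
    rcases hc.length_le.lt_or_eq with h | h
    · exact h
    · exact absurd (hc.eq_of_length h) hne
  have hA : (∑ a ∈ U.erase b, x a) ^ 2 ≤ ∑ a ∈ U.erase b, (x a) ^ 2 := by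
    apply IH
    · refine ⟨fun a ha c hc => hUseg.1 a (Finset.mem_of_mem_erase ha) c
        (Finset.mem_of_mem_erase hc), ?_⟩
      intro a ha d hd c hac hcd
      have hd' := Finset.mem_erase.1 hd
      refine Finset.mem_coe.2 (Finset.mem_erase.2
        ⟨?_, hUseg.2 a (Finset.mem_of_mem_erase ha) d hd'.2 c hac hcd⟩)
      rintro rfl
      exact hd'.1 ((hUb d hd'.2).eq_of_length_le hcd.length_le)
    · intro c hc
      have hc' := Finset.mem_erase.1 hc
      exact hlen c (hUb c hc'.2) hc'.1
  have hne : ((U.erase b).filter (fun c => x c ≠ 0)).Nonempty := by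
    by_contra hemp
    rw [Finset.not_nonempty_iff_eq_empty, Finset.filter_eq_empty_iff] at hemp
    have h0 : ∑ a ∈ U.erase b, x a = 0 :=
      Finset.sum_eq_zero (fun a ha => by simpa using hemp ha)
    rw [← Finset.add_sum_erase U _ hbU, ← Finset.add_sum_erase U x hbU, h0] at hlt
    have : 0 ≤ ∑ a ∈ U.erase b, (x a) ^ 2 := Finset.sum_nonneg (fun _ _ => sq_nonneg _)
    rw [add_zero] at hlt
    linarith
  obtain ⟨b', hb', hmax⟩ := Finset.exists_max_image _ (fun c => c.length) hne
  rw [Finset.mem_filter, Finset.mem_erase] at hb'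
  obtain ⟨⟨hb'b, hb'U⟩, hxb'⟩ := hb'
  obtain ⟨P, ⟨hP, hPn⟩, S1, hS1, S, hSP, hS1S, hb'S1, hbS⟩ :=
    hsep b' (mem_ran hxb') b (mem_ran hxb) hb'b
  have hdisj : ∀ V ∈ P, ∀ V' ∈ P, ∀ c, c ∈ V → c ∈ V' → V = V' := by
    intro V hV V' hV' c hc hc'
    by_contra hne
    exact Set.disjoint_left.1 (hP.2 hV hV' hne) hc hc'
  have hb'S : b' ∉ S := fun h => hS1S (hdisj S1 hS1 S hSP b' hb'S1 h)
  have hSseg := hP.1 S hSP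
  have hSb : ∀ c ∈ S, c <+: b → c ∈ U := by
    intro c hc hcb
    rcases List.prefix_or_prefix_of_prefix hcb (hUb b' hb'U) with h | h
    · exact absurd (hSseg.2 c hc b hbS b' h (hUb b' hb'U)) hb'S
    · exact hUseg.2 b' hb'U b hbU c h hcb
  have hSU : ∀ c ∈ S, c ∈ U → x c ≠ 0 → c = b := by
    intro c hc hcU hxc
    by_contra hcb
    have hle := hmax c (Finset.mem_filter.2 ⟨Finset.mem_erase.2 ⟨hcb, hcU⟩, hxc⟩)
    have := List.prefix_of_prefix_length_le (hUb c hcU) (hUb b' hb'U) hle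
    exact hb'S (hSseg.2 c hc b hbS b' this (hUb b' hb'U))
  obtain ⟨W, hWseg, hWd, hWsub, hW⟩ :=
    gain hUseg hbU hUb hSseg hbS hSb hSU hA hlt
  let D : Set (Set DyadicNode) := {V | V ∈ P ∧ V ≠ S ∧ ∃ c ∈ U, c ∈ V}
  have hDfin : D.Finite := by
    have hsub : D ⊆ ⋃ c ∈ (U : Set DyadicNode), {V | V ∈ P ∧ c ∈ V} := by
      rintro V ⟨hV, _, c, hc, hcV⟩
      simp only [Set.mem_iUnion]
      exact ⟨c, hc, hV, hcV⟩
    refine (Set.Finite.biUnion U.finite_toSet (fun c _ => ?_)).subset hsub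
    apply Set.Subsingleton.finite
    rintro V ⟨hV, hcV⟩ V' ⟨hV', hcV'⟩
    exact hdisj V hV V' hV' c hcV hcV'
  let Df : Finset (Set DyadicNode) := hDfin.toFinset
  have hDf : ∀ V, V ∈ Df ↔ (V ∈ P ∧ V ≠ S ∧ ∃ c ∈ U, c ∈ V) := by
    intro V; exact hDfin.mem_toFinset
  let B : Finset DyadicNode := b.inits.toFinset.erase b
  have hB : ∀ c, c ∈ B ↔ c ≠ b ∧ c <+: b := by
    intro c; simp [B]
  have hDsupp : ∀ V ∈ Df, ∀ u ∈ V, x u ≠ 0 → u ∈ B := by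
    intro V hV u hu hxu
    obtain ⟨hVP, hVS, c, hcU, hcV⟩ := (hDf V).1 hV
    have hbV : b ∉ V := fun h => hVS (hdisj V hVP S hSP b h hbS)
    rw [hB]
    refine ⟨fun h => hbV (h ▸ hu), ?_⟩
    rcases (hP.1 V hVP).1 u hu c hcV with h | h
    · exact h.trans (hUb c hcU)
    · obtain ⟨a, haU, hxa, hac⟩ := hUa c hcU
      rcases hC a u b hxa hxu hxb (hac.trans h) (hUb a haU) with h' | h'
      · exact h'
      · exact absurd ((hP.1 V hVP).2 c hcV u hu b (hUb c hcU) h') hbV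
  have hDle : ∀ V ∈ Df, (segSum x V) ^ 2 ≤ ∑ a ∈ B.filter (· ∈ V), (x a) ^ 2 := by
    intro V hV
    rw [segSum_finset x V B (hDsupp V hV)]
    have hVseg := hP.1 V ((hDf V).1 hV).1
    apply IH
    · refine ⟨fun a ha c hc => hVseg.1 a (Finset.mem_filter.1 ha).2 c
        (Finset.mem_filter.1 hc).2, ?_⟩
      intro a ha d hd c hac hcd
      have ha' := Finset.mem_filter.1 ha
      have hd' := Finset.mem_filter.1 hd
      have hdB := (hB d).1 hd'.1
      refine Finset.mem_coe.2 (Finset.mem_filter.2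
        ⟨(hB c).2 ⟨?_, hcd.trans hdB.2⟩, hVseg.2 a ha'.2 d hd'.2 c hac hcd⟩)
      rintro rfl
      exact hdB.1 (hdB.2.eq_of_length_le hcd.length_le)
    · intro c hc
      have := (hB c).1 (Finset.mem_filter.1 hc).1
      exact hlen c this.2 this.1
  let E : Finset DyadicNode := (B.filter (fun c => ∃ V ∈ Df, c ∈ V)).filter (· ∉ U)
  have hDsum : ∑ V ∈ Df, (segSum x V) ^ 2 ≤
      ∑ a ∈ E, (x a) ^ 2 + ∑ a ∈ U.erase b, (x a) ^ 2 := by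
    calc ∑ V ∈ Df, (segSum x V) ^ 2
        ≤ ∑ V ∈ Df, ∑ a ∈ B.filter (· ∈ V), (x a) ^ 2 := Finset.sum_le_sum hDle
      _ = ∑ a ∈ Df.biUnion (fun V => B.filter (· ∈ V)), (x a) ^ 2 := by
          rw [Finset.sum_biUnion]
          intro V hV V' hV' hne
          rw [Function.onFun, Finset.disjoint_left]
          intro c hc hc'
          exact hne (hdisj V ((hDf V).1 hV).1 V' ((hDf V').1 hV').1 c
            (Finset.mem_filter.1 hc).2 (Finset.mem_filter.1 hc').2)
      _ ≤ ∑ a ∈ E ∪ U.erase b, (x a) ^ 2 := by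
          apply Finset.sum_le_sum_of_subset_of_nonneg
          · intro c hc
            obtain ⟨V, hV, hcV⟩ := Finset.mem_biUnion.1 hc
            have hcV' := Finset.mem_filter.1 hcV
            rw [Finset.mem_union]
            by_cases hcU : c ∈ U
            · exact Or.inr (Finset.mem_erase.2 ⟨((hB c).1 hcV'.1).1, hcU⟩)
            · exact Or.inl (Finset.mem_filter.2
                ⟨Finset.mem_filter.2 ⟨hcV'.1, V, hV, hcV'.2⟩, hcU⟩)
          · intro _ _ _; exact sq_nonneg _
      _ = _ := by
          rw [Finset.sum_union]
          rw [Finset.disjoint_left]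
          intro c hc hc'
          exact (Finset.mem_filter.1 hc).2 (Finset.mem_of_mem_erase hc')
  set δ := (segSum x (W true)) ^ 2 + (segSum x (W false)) ^ 2 -
    (∑ a ∈ U.erase b, (x a) ^ 2 + (segSum x S) ^ 2) with hδ
  have hδpos : 0 < δ := by rw [hδ]; linarith
  obtain ⟨G, hG⟩ : ∃ G : Finset P, JTnormSq x - δ < ∑ V ∈ G, (segSum x V) ^ 2 := by
    have hsum := (p_summable hb hP).hasSum
    have : ∑' V : P, (segSum x V) ^ 2 = JTnormSq x := hPn
    rw [this] at hsum
    exact (hsum.eventually (lt_mem_nhds (by linarith : JTnormSq x - δ < JTnormSq x))).exists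
  let G' : Finset (Set DyadicNode) := G.map (Function.Embedding.subtype _)
  have hG'P : ∀ V ∈ G', V ∈ P := by
    intro V hV
    obtain ⟨V', _, rfl⟩ := Finset.mem_map.1 hV
    exact V'.2
  have hG'sum : ∑ V ∈ G', (segSum x V) ^ 2 = ∑ V ∈ G, (segSum x V) ^ 2 := by
    simp [G']
  let H : Finset (Set DyadicNode) := G' \ (insert S Df)
  have hGH : ∑ V ∈ G', (segSum x V) ^ 2 ≤
      ∑ V ∈ H, (segSum x V) ^ 2 + ((segSum x S) ^ 2 + ∑ V ∈ Df, (segSum x V) ^ 2) := by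
    have hSD : S ∉ Df := fun h => ((hDf S).1 h).2.1 rfl
    rw [← Finset.sum_insert (f := fun V => (segSum x V) ^ 2) hSD, ← Finset.sum_union Finset.sdiff_disjoint]
    apply Finset.sum_le_sum_of_subset_of_nonneg
    · rw [Finset.sdiff_union_self_eq_union]
      exact Finset.subset_union_left
    · intro _ _ _; exact sq_nonneg _
  have hHP : ∀ V ∈ H, V ∈ P ∧ V ≠ S ∧ V ∉ Df := by
    intro V hV
    have := Finset.mem_sdiff.1 hV
    refine ⟨hG'P V this.1, ?_, ?_⟩
    · rintro rfl; exact this.2 (Finset.mem_insert_self _ _)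
    · intro h; exact this.2 (Finset.mem_insert_of_mem h)
  have hHU : ∀ V ∈ H, ∀ c ∈ V, c ∉ U := by
    intro V hV c hc hcU
    have := hHP V hV
    exact this.2.2 ((hDf V).2 ⟨this.1, this.2.1, c, hcU, hc⟩)
  have hHW : ∀ V ∈ H, ∀ i, Disjoint V (W i) := by
    intro V hV i
    rw [Set.disjoint_left]
    intro c hc hcW
    rcases hWsub i hcW with h | h
    · exact hHU V hV c hc h
    · exact (hHP V hV).2.1 (hdisj V (hHP V hV).1 S hSP c hc h)
  have hE : ∀ c ∈ E, c ∉ U ∧ ∃ V ∈ Df, c ∈ V := by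
    intro c hc
    have h1 := Finset.mem_filter.1 hc
    exact ⟨h1.2, (Finset.mem_filter.1 h1.1).2⟩
  have hEW : ∀ c ∈ E, ∀ i, Disjoint {c} (W i) := by
    intro c hc i
    rw [Set.disjoint_singleton_left]
    intro hcW
    obtain ⟨hcU, V, hV, hcV⟩ := hE c hc
    rcases hWsub i hcW with h | h
    · exact hcU h
    · have := (hDf V).1 hV
      exact this.2.1 (hdisj V this.1 S hSP c hcV h)
  have hEH : ∀ c ∈ E, ∀ V ∈ H, Disjoint {c} V := by
    intro c hc V hV
    rw [Set.disjoint_singleton_left]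
    intro hcV
    obtain ⟨hcU, V', hV', hcV'⟩ := hE c hc
    have := hdisj V (hHP V hV).1 V' ((hDf V').1 hV').1 c hcV hcV'
    exact (hHP V hV).2.2 (this ▸ hV')
  have hfam := fam_le hb (H.disjSum (E.disjSum (Finset.univ : Finset Bool)))
    (Sum.elim id (Sum.elim (fun c => {c}) W)) (by
      rintro (V | c | i) h
      · exact hP.1 V (hHP V (by simpa using h)).1
      · exact isSegment_singleton c
      · exact hWseg i) (by
      rintro (V | c | i) h (V' | c' | i') h' hne
      · have hV := hHP V (by simpa using h)
        have hV' := hHP V' (by simpa using h')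
        exact hP.2 hV.1 hV'.1 (fun e => hne (congrArg Sum.inl e))
      · exact (hEH c' (by simpa using h') V (by simpa using h)).symm
      · exact hHW V (by simpa using h) i'
      · exact hEH c (by simpa using h) V' (by simpa using h')
      · simpa using hne
      · exact hEW c (by simpa using h) i'
      · exact (hHW V' (by simpa using h') i).symm
      · exact (hEW c' (by simpa using h') i).symm
      · cases i <;> cases i'
        · exact absurd rfl hne
        · exact hWd.symm
        · exact hWd
        · exact absurd rfl hne)
  rw [Finset.sum_disjSum, Finset.sum_disjSum] at hfam
  simp only [Sum.elim_inl, Sum.elim_inr, id, segSum_singleton, Fintype.sum_bool] at hfam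
  linarith

lemma key {x : DyadicNode → ℝ} (hb : HasBddNorm x) (hsep : Separated x)
    (hC : ∀ a u b, x a ≠ 0 → x u ≠ 0 → x b ≠ 0 → a <+: u → a <+: b → u <+: b ∨ b <+: u) :
    ∀ n : ℕ, ∀ U : Finset DyadicNode, IsSegment (U : Set DyadicNode) →
      (∀ c ∈ U, c.length < n) → (∑ a ∈ U, x a) ^ 2 ≤ ∑ a ∈ U, (x a) ^ 2 := by
  classical
  intro n
  induction n with
  | zero =>
    intro U _ h
    have : U = ∅ := Finset.eq_empty_of_forall_notMem (fun c hc => by simpa using h c hc)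
    simp [this]
  | succ n ih =>
    intro U hU hlen
    let U' : Finset DyadicNode := U.filter
      (fun c => (∃ a ∈ U, x a ≠ 0 ∧ a <+: c) ∧ (∃ b ∈ U, x b ≠ 0 ∧ c <+: b))
    have hU' : ∀ c, c ∈ U' ↔ c ∈ U ∧ (∃ a ∈ U, x a ≠ 0 ∧ a <+: c) ∧
        (∃ b ∈ U, x b ≠ 0 ∧ c <+: b) := by
      intro c; exact Finset.mem_filter
    have hmem : ∀ c ∈ U, x c ≠ 0 → c ∈ U' := fun c hc h =>
      (hU' c).2 ⟨hc, ⟨c, hc, h, List.prefix_rfl⟩, ⟨c, hc, h, List.prefix_rfl⟩⟩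
    have e1 : ∑ a ∈ U', x a = ∑ a ∈ U, x a := by
      apply Finset.sum_subset (Finset.filter_subset _ _)
      intro c hc hc'
      by_contra h; exact hc' (hmem c hc h)
    have e2 : ∑ a ∈ U', (x a) ^ 2 = ∑ a ∈ U, (x a) ^ 2 := by
      apply Finset.sum_subset (Finset.filter_subset _ _)
      intro c hc hc'
      by_contra h; exact hc' (hmem c hc (fun h0 => h (by rw [h0]; norm_num)))
    rw [← e1, ← e2]
    have hU'seg : IsSegment (U' : Set DyadicNode) := by
      refine ⟨fun a ha c hc => hU.1 a ((hU' a).1 ha).1 c ((hU' c).1 hc).1, ?_⟩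
      intro a ha d hd c hac hcd
      obtain ⟨haU, ⟨a', ha'U, hxa', ha'⟩, _⟩ := (hU' a).1 ha
      obtain ⟨hdU, _, ⟨d', hd'U, hxd', hd'⟩⟩ := (hU' d).1 hd
      exact (hU' c).2 ⟨hU.2 a haU d hdU c hac hcd, ⟨a', ha'U, hxa', ha'.trans hac⟩,
        ⟨d', hd'U, hxd', hcd.trans hd'⟩⟩
    by_cases hne : U'.Nonempty
    · obtain ⟨b, hbU', hmax⟩ := Finset.exists_max_image U' (fun c => c.length) hne
      have hUb : ∀ c ∈ U', c <+: b := by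
        intro c hc
        rcases hU'seg.1 c hc b hbU' with h | h
        · exact h
        · rw [h.eq_of_length_le (hmax c hc)]
      have hxb : x b ≠ 0 := by
        obtain ⟨_, _, ⟨d, hdU, hxd, hbd⟩⟩ := (hU' b).1 hbU'
        have := hbd.eq_of_length_le (hmax d (hmem d hdU hxd))
        rw [this]; exact hxd
      refine step hb hsep hC hU'seg hbU' hUb hxb ?_ ?_
      · intro c hc
        obtain ⟨_, ⟨a, haU, hxa, hac⟩, _⟩ := (hU' c).1 hc
        exact ⟨a, hmem a haU hxa, hxa, hac⟩
      · intro V hV hVlen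
        refine ih V hV (fun c hc => ?_)
        have h1 := hVlen c hc
        have h2 := hlen b ((hU' b).1 hbU').1
        omega
    · rw [Finset.not_nonempty_iff_eq_empty] at hne
      simp [hne]

/-- If `x ∈ JT` is supported on a union of pairwise incomparable segments
and is separated, then `‖x‖_{JT} = ‖x‖₂`; consequently `x` is an extreme point of the ball
of radius `‖x‖_{JT}`. -/
theorem incomparable_segments_separated (x : DyadicNode → ℝ) (hx : MemJT x)
    {ι : Type} (S : ι → Set DyadicNode) (hseg : ∀ i, IsSegment (S i))
    (hinc : ∀ i j, i ≠ j → ∀ a ∈ S i, ∀ b ∈ S j, ¬ a <+: b ∧ ¬ b <+: a)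
    (hsupp : Function.support x ⊆ ⋃ i, S i)
    (hsep : Separated x) :
    JTnorm x = l2norm x ∧ (x ≠ 0 → IsExtremePoint x) := by
  have hC : ∀ a u b, x a ≠ 0 → x u ≠ 0 → x b ≠ 0 → a <+: u → a <+: b →
      u <+: b ∨ b <+: u := by
    intro a u b ha hu hb hau hab
    obtain ⟨i, hi⟩ := Set.mem_iUnion.1 (hsupp ha)
    obtain ⟨j, hj⟩ := Set.mem_iUnion.1 (hsupp hu)
    obtain ⟨k, hk⟩ := Set.mem_iUnion.1 (hsupp hb)
    have hij : i = j := by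
      by_contra h; exact (hinc i j h a hi u hj).1 hau
    have hik : i = k := by
      by_contra h; exact (hinc i k h a hi b hk).1 hab
    subst hij
    subst hik
    exact (hseg i).1 u hj b hk
  have hkey : ∀ U : Finset DyadicNode, IsSegment (U : Set DyadicNode) →
      (∑ a ∈ U, x a) ^ 2 ≤ ∑ a ∈ U, (x a) ^ 2 := by
    intro U hU
    refine key hx.1 hsep hC (U.sup List.length + 1) U hU (fun c hc => ?_)
    exact Nat.lt_succ_of_le (Finset.le_sup (f := List.length) hc)
  have heq := normSq_eq hx.1 hkey
  refine ⟨?_, fun h0 => extreme_of_eq hx.1 heq h0⟩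
  unfold JTnorm l2norm
  rw [heq]

end JTSpace
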